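/- Let u, v : ℝ × ℝ → ℝ be smooth functions of (x,t) solving the generalized Riemann equation at N=2, i.e. u_t = 2u·u_x − 2v and v_t = 2u·v_x, with v_x nowhere zero, and let Q : ℝ → ℝ be any smooth function. Then the function H = −(1/4)·v_x·Q′(α₁)·α₂·β₁² − (1/2)·v_x·Q(α₁)·β₁·β₂ satisfies the conservation law ∂_t H = ∂_x(2u·H + Q(α₁)·β₁) at every point. -/

import Mathlib

/-- Partial derivative with respect to the first variable `x`. -/
noncomputable def pdx (f : ℝ × ℝ → ℝ) (p : ℝ × ℝ) : ℝ := deriv (fun x => f (x, p.2)) p.1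

/-- Partial derivative with respect to the second variable `t`. -/
noncomputable def pdt (f : ℝ × ℝ → ℝ) (p : ℝ × ℝ) : ℝ := deriv (fun t => f (p.1, t)) p.2

open scoped ContDiff

/-- Slices of a differentiable function in the first variable have derivative `pdx`. -/
lemma Differentiable.hasDerivAt_pdx {f : ℝ × ℝ → ℝ} (hf : Differentiable ℝ f) (p : ℝ × ℝ) :
    HasDerivAt (fun x => f (x, p.2)) (pdx f p) p.1 := by
  have h : Differentiable ℝ fun x : ℝ => f (x, p.2) := by fun_prop
  exact (h p.1).hasDerivAt

/-- Slices of a differentiable function in the second variable have derivative `pdt`. -/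
lemma Differentiable.hasDerivAt_pdt {f : ℝ × ℝ → ℝ} (hf : Differentiable ℝ f) (p : ℝ × ℝ) :
    HasDerivAt (fun t => f (p.1, t)) (pdt f p) p.2 := by
  have h : Differentiable ℝ fun t : ℝ => f (p.1, t) := by fun_prop
  exact (h p.2).hasDerivAt

lemma Differentiable.pdx_eq_fderiv {f : ℝ × ℝ → ℝ} (hf : Differentiable ℝ f) (p : ℝ × ℝ) :
    pdx f p = fderiv ℝ f p (1, 0) :=
  ((hf p).hasFDerivAt.comp_hasDerivAt (f := fun x => (x, p.2)) p.1
    ((hasDerivAt_id p.1).prodMk (hasDerivAt_const p.1 p.2))).deriv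

lemma Differentiable.pdt_eq_fderiv {f : ℝ × ℝ → ℝ} (hf : Differentiable ℝ f) (p : ℝ × ℝ) :
    pdt f p = fderiv ℝ f p (0, 1) :=
  ((hf p).hasFDerivAt.comp_hasDerivAt (f := fun t => (p.1, t)) p.2
    ((hasDerivAt_const p.2 p.1).prodMk (hasDerivAt_id p.2))).deriv

lemma ContDiff.differentiable_of_infty {f : ℝ × ℝ → ℝ} (hf : ContDiff ℝ ∞ f) :
    Differentiable ℝ f :=
  hf.differentiable (by simp)

lemma ContDiff.contDiff_pdx {f : ℝ × ℝ → ℝ} (hf : ContDiff ℝ ∞ f) : ContDiff ℝ ∞ (pdx f) := by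
  rw [funext hf.differentiable_of_infty.pdx_eq_fderiv]
  exact (hf.fderiv_right (m := ∞) le_rfl).clm_apply contDiff_const

lemma ContDiff.contDiff_pdt {f : ℝ × ℝ → ℝ} (hf : ContDiff ℝ ∞ f) : ContDiff ℝ ∞ (pdt f) := by
  rw [funext hf.differentiable_of_infty.pdt_eq_fderiv]
  exact (hf.fderiv_right (m := ∞) le_rfl).clm_apply contDiff_const

/-- Partial derivatives of a smooth function commute. -/
lemma ContDiff.pdt_pdx_comm {f : ℝ × ℝ → ℝ} (hf : ContDiff ℝ ∞ f) (p : ℝ × ℝ) :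
    pdt (pdx f) p = pdx (pdt f) p := by
  have hd : Differentiable ℝ (fderiv ℝ f) :=
    (hf.fderiv_right (m := ∞) le_rfl).differentiable (by simp)
  have hsymm : IsSymmSndFDerivAt ℝ f p :=
    (contDiff_infty.mp hf 2).contDiffAt.isSymmSndFDerivAt (by simp)
  rw [hf.contDiff_pdx.differentiable_of_infty.pdt_eq_fderiv, hf.contDiff_pdt.differentiable_of_infty.pdx_eq_fderiv,
    funext hf.differentiable_of_infty.pdx_eq_fderiv,
    funext hf.differentiable_of_infty.pdt_eq_fderiv,
    fderiv_clm_apply (hd p) (differentiableAt_const _),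
    fderiv_clm_apply (hd p) (differentiableAt_const _)]
  simpa using hsymm.eq (0, 1) (1, 0)

/-- If `V` is transported as a density and `f` is advected up to a constant source, then
`V⁻¹ * pdx f` is advected. -/
lemma pdt_inv_mul_pdx {u V f g : ℝ × ℝ → ℝ} {c : ℝ} (hu : ContDiff ℝ ∞ u)
    (hV : ContDiff ℝ ∞ V) (hf : ContDiff ℝ ∞ f) (hg : ContDiff ℝ ∞ g) (hV0 : ∀ p, V p ≠ 0)
    (hVt : ∀ p, pdt V p = 2 * pdx u p * V p + 2 * u p * pdx V p)
    (hft : ∀ p, pdt f p = 2 * u p * pdx f p + c)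
    (hgf : ∀ p, g p = (V p)⁻¹ * pdx f p) (p : ℝ × ℝ) :
    pdt g p = 2 * u p * pdx g p := by
  have hfx : pdx f = fun q => V q * g q := by
    funext q
    rw [hgf, mul_inv_cancel_left₀ (hV0 q)]
  have ht : pdt (pdx f) p = pdt V p * g p + V p * pdt g p := by
    rw [hfx]
    exact ((hV.differentiable_of_infty.hasDerivAt_pdt p).mul
      (hg.differentiable_of_infty.hasDerivAt_pdt p)).deriv
  have hx : pdx (pdt f) p
      = 2 * pdx u p * (V p * g p) + 2 * u p * (pdx V p * g p + V p * pdx g p) := by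
    rw [funext hft, hfx]
    exact ((((hu.differentiable_of_infty.hasDerivAt_pdx p).const_mul 2).mul
      ((hV.differentiable_of_infty.hasDerivAt_pdx p).mul
        (hg.differentiable_of_infty.hasDerivAt_pdx p))).add_const c).deriv
  have h := hf.pdt_pdx_comm p
  rw [ht, hx, hVt] at h
  apply mul_left_cancel₀ (hV0 p)
  linear_combination h

theorem riemannN2_example_conservation_law (u v : ℝ × ℝ → ℝ)
    (hu : ContDiff ℝ (⊤ : ℕ∞) u) (hv : ContDiff ℝ (⊤ : ℕ∞) v)
    (hequ : ∀ p : ℝ × ℝ, pdt u p = 2 * u p * pdx u p - 2 * v p)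
    (heqv : ∀ p : ℝ × ℝ, pdt v p = 2 * u p * pdx v p)
    (hvx : ∀ p : ℝ × ℝ, pdx v p ≠ 0)
    (Q : ℝ → ℝ) (hQ : ContDiff ℝ (⊤ : ℕ∞) Q)
    (α β : ℕ → ℝ × ℝ → ℝ)
    (hα1 : ∀ p : ℝ × ℝ, α 1 p = (pdx u p) ^ 2 * ((pdx v p) ^ 2)⁻¹ - 2 * (pdx v p)⁻¹)
    (hβ1 : ∀ p : ℝ × ℝ, β 1 p = pdx u p * (pdx v p)⁻¹)
    (hαrec : ∀ k, 1 ≤ k → ∀ p : ℝ × ℝ, α (k + 1) p = (pdx v p)⁻¹ * pdx (α k) p)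
    (hβrec : ∀ k, 1 ≤ k → ∀ p : ℝ × ℝ, β (k + 1) p = (pdx v p)⁻¹ * pdx (β k) p) :
    ∀ p : ℝ × ℝ,
      pdt (fun q => -(1 / 4) * pdx v q * deriv Q (α 1 q) * α 2 q * (β 1 q) ^ 2
      - 1 / 2 * pdx v q * Q (α 1 q) * β 1 q * β 2 q) p
        = pdx (fun q => 2 * u q * ((fun q => -(1 / 4) * pdx v q * deriv Q (α 1 q) * α 2 q * (β 1 q) ^ 2
      - 1 / 2 * pdx v q * Q (α 1 q) * β 1 q * β 2 q) q) + Q (α 1 q) * β 1 q) p := by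
  have hU : ContDiff ℝ ∞ (pdx u) := hu.contDiff_pdx
  have hV : ContDiff ℝ ∞ (pdx v) := hv.contDiff_pdx
  have hA : ContDiff ℝ ∞ (α 1) := by
    rw [funext hα1]
    exact ((hU.pow 2).mul ((hV.pow 2).inv fun p => pow_ne_zero 2 (hvx p))).sub
      (contDiff_const.mul (hV.inv hvx))
  have hB : ContDiff ℝ ∞ (β 1) := by
    rw [funext hβ1]
    exact hU.mul (hV.inv hvx)
  have hA2 : ContDiff ℝ ∞ (α 2) := by
    rw [funext (hαrec 1 le_rfl)]
    exact (hV.inv hvx).mul hA.contDiff_pdx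
  have hB2 : ContDiff ℝ ∞ (β 2) := by
    rw [funext (hβrec 1 le_rfl)]
    exact (hV.inv hvx).mul hB.contDiff_pdx
  have hUt : ∀ p, pdt (pdx u) p
      = 2 * pdx u p ^ 2 + 2 * u p * pdx (pdx u) p - 2 * pdx v p := fun p => by
    have h := (congrFun (congrArg pdx (funext hequ)) p).trans
      ((((hu.differentiable_of_infty.hasDerivAt_pdx p).const_mul 2).mul
        (hU.differentiable_of_infty.hasDerivAt_pdx p)).sub
        ((hv.differentiable_of_infty.hasDerivAt_pdx p).const_mul 2)).deriv
    rw [hu.pdt_pdx_comm, h]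
    ring
  have hVt : ∀ p, pdt (pdx v) p
      = 2 * pdx u p * pdx v p + 2 * u p * pdx (pdx v) p := fun p => by
    have h := (congrFun (congrArg pdx (funext heqv)) p).trans
      (((hu.differentiable_of_infty.hasDerivAt_pdx p).const_mul 2).mul
        (hV.differentiable_of_infty.hasDerivAt_pdx p)).deriv
    rw [hv.pdt_pdx_comm, h]
  have hBt : ∀ p, pdt (β 1) p = 2 * u p * pdx (β 1) p + -2 := fun p => by
    have ht := (congrFun (congrArg pdt (funext hβ1)) p).trans
      ((hU.differentiable_of_infty.hasDerivAt_pdt p).mul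
        ((hV.differentiable_of_infty.hasDerivAt_pdt p).inv (hvx p))).deriv
    have hx := (congrFun (congrArg pdx (funext hβ1)) p).trans
      ((hU.differentiable_of_infty.hasDerivAt_pdx p).mul
        ((hV.differentiable_of_infty.hasDerivAt_pdx p).inv (hvx p))).deriv
    have h0 := hvx p
    rw [ht, hx, hUt, hVt]
    simp only [Pi.inv_apply, Prod.mk.eta]
    field_simp
    ring
  have hAt : ∀ p, pdt (α 1) p = 2 * u p * pdx (α 1) p + 0 := fun p => by
    have hα : α 1 = fun q => β 1 q ^ 2 - 2 * (pdx v q)⁻¹ := by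
      funext q
      rw [hα1, hβ1, mul_pow, inv_pow]
    have ht := (congrFun (congrArg pdt hα) p).trans
      (((hB.differentiable_of_infty.hasDerivAt_pdt p).pow 2).sub
        (((hV.differentiable_of_infty.hasDerivAt_pdt p).inv (hvx p)).const_mul 2)).deriv
    have hx := (congrFun (congrArg pdx hα) p).trans
      (((hB.differentiable_of_infty.hasDerivAt_pdx p).pow 2).sub
        (((hV.differentiable_of_infty.hasDerivAt_pdx p).inv (hvx p)).const_mul 2)).deriv
    have h0 := hvx p
    rw [ht, hx, hBt, hVt]
    simp only [Prod.mk.eta, hβ1, Nat.reduceSub, pow_one, Nat.cast_ofNat]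
    field_simp
    ring
  have hA2t := pdt_inv_mul_pdx hu hV hA hA2 hvx hVt hAt (hαrec 1 le_rfl)
  have hB2t := pdt_inv_mul_pdx hu hV hB hB2 hvx hVt hBt (hβrec 1 le_rfl)
  have hAx : ∀ p, pdx (α 1) p = pdx v p * α 2 p := fun p => by
    rw [hαrec 1 le_rfl, mul_inv_cancel_left₀ (hvx p)]
  have hBx : ∀ p, pdx (β 1) p = pdx v p * β 2 p := fun p => by
    rw [hβrec 1 le_rfl, mul_inv_cancel_left₀ (hvx p)]
  intro p
  have hQ1 : ∀ y, HasDerivAt Q (deriv Q y) y := fun y =>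
    (hQ.differentiable (by simp) y).hasDerivAt
  have hQ2 : ∀ y, HasDerivAt (deriv Q) (deriv (deriv Q) y) y := fun y =>
    ((contDiff_infty_iff_deriv.mp hQ).2.differentiable (by simp) y).hasDerivAt
  have dVx := hV.differentiable_of_infty.hasDerivAt_pdx p
  have dAx := hA.differentiable_of_infty.hasDerivAt_pdx p
  have dBx := hB.differentiable_of_infty.hasDerivAt_pdx p
  have dA2x := hA2.differentiable_of_infty.hasDerivAt_pdx p
  have dB2x := hB2.differentiable_of_infty.hasDerivAt_pdx p
  have dVt := hV.differentiable_of_infty.hasDerivAt_pdt p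
  have dAt := hA.differentiable_of_infty.hasDerivAt_pdt p
  have dBt := hB.differentiable_of_infty.hasDerivAt_pdt p
  have dA2t := hA2.differentiable_of_infty.hasDerivAt_pdt p
  have dB2t := hB2.differentiable_of_infty.hasDerivAt_pdt p
  have dQx := (hQ1 (α 1 p)).comp p.1 dAx
  have dDQx := (hQ2 (α 1 p)).comp p.1 dAx
  have dQt := (hQ1 (α 1 p)).comp p.2 dAt
  have dDQt := (hQ2 (α 1 p)).comp p.2 dAt
  have dHt := ((((dVt.const_mul (-(1 / 4))).mul dDQt).mul dA2t).mul (dBt.pow 2)).sub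
    ((((dVt.const_mul (1 / 2)).mul dQt).mul dBt).mul dB2t)
  have dHx := ((((dVx.const_mul (-(1 / 4))).mul dDQx).mul dA2x).mul (dBx.pow 2)).sub
    ((((dVx.const_mul (1 / 2)).mul dQx).mul dBx).mul dB2x)
  have dFx := (((hu.differentiable_of_infty.hasDerivAt_pdx p).const_mul 2).mul dHx).add
    (dQx.mul dBx)
  refine dHt.deriv.trans (Eq.trans ?_ dFx.deriv.symm)
  simp only [Function.comp_apply, Pi.mul_apply, Pi.sub_apply, Pi.pow_apply, Prod.mk.eta,
    hVt, hAt, hBt, hA2t, hB2t, hAx, hBx]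
  push_cast
  ring
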